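/- arXiv:2512.08519 — 6 statements merged into one kernel-verified Lean document; each statement's English description precedes it below -/
import Mathlib

section
/- Let (X,T) be a topological dynamical system, i.e. X is a metric space and T : X → X is continuous. Then the following are equivalent: (i) (X,T) is weakly mixing; (ii) (X,T) is F_t-transitive, where F_t is the family of thick subsets of ℕ; (iii) the collection N_T = {A ⊆ ℕ : N(U,V) ⊆ A for some nonempty open subsets U, V of X} does not contain the empty set and is closed under finite intersections (i.e. N_T is a filter in the Furstenberg-family sense). -/
open Set Topology Function Filter
open scoped ENNReal

/- ### Basic dynamical notions -/

/-- The return time set `N(U,V) = {n ∈ ℕ : T^n(U) ∩ V ≠ ∅}`. -/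
def nset {X : Type*} (T : X → X) (U V : Set X) : Set ℕ :=
  {n : ℕ | ∃ x ∈ U, T^[n] x ∈ V}

/-- A Furstenberg family: nonempty, hereditary upward, not containing `∅`. -/
def IsFamily (F : Set (Set ℕ)) : Prop :=
  F.Nonempty ∧ (∀ ⦃A B : Set ℕ⦄, A ∈ F → A ⊆ B → B ∈ F) ∧ ∅ ∉ F

/-- `T` is `F`-transitive. -/
def FTrans {X : Type*} [TopologicalSpace X] (T : X → X) (F : Set (Set ℕ)) : Prop :=
  ∀ U V : Set X, IsOpen U → IsOpen V → U.Nonempty → V.Nonempty → nset T U V ∈ F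

/-- Direct sum (product) of two maps. -/
def prodMap' {X Y : Type*} (T : X → X) (S : Y → Y) : X × Y → X × Y :=
  fun p => (T p.1, S p.2)

/-- `T` is `F`-mixing: `T × T` is `F`-transitive. -/
def FMix {X : Type*} [TopologicalSpace X] (T : X → X) (F : Set (Set ℕ)) : Prop :=
  FTrans (prodMap' T T) F

/-- Topological transitivity. -/
def TopTrans {X : Type*} [TopologicalSpace X] (T : X → X) : Prop :=
  ∀ U V : Set X, IsOpen U → IsOpen V → U.Nonempty → V.Nonempty → (nset T U V).Nonempty

/-- Weak mixing: `T × T` is topologically transitive. -/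
def WMix {X : Type*} [TopologicalSpace X] (T : X → X) : Prop :=
  TopTrans (prodMap' T T)

/-- Hypercyclicity: some point has dense orbit. -/
def HypercyclicMap {X : Type*} [TopologicalSpace X] (T : X → X) : Prop :=
  ∃ x : X, Dense (Set.range fun n : ℕ => T^[n] x)

/-- Weak disjointness: the direct sum is hypercyclic. -/
def WeaklyDisjoint {X Y : Type*} [TopologicalSpace X] [TopologicalSpace Y]
    (T : X → X) (S : Y → Y) : Prop :=
  HypercyclicMap (prodMap' T S)

/-- The family generated by the return time sets of `T`. -/
def NTfam {X : Type*} [TopologicalSpace X] (T : X → X) : Set (Set ℕ) :=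
  {A : Set ℕ | ∃ U V : Set X, IsOpen U ∧ IsOpen V ∧ U.Nonempty ∧ V.Nonempty ∧ nset T U V ⊆ A}

/- ### Combinatorial families -/

/-- `(A + i) ∩ ℕ` for `i : ℤ`. -/
def shiftSet (A : Set ℕ) (i : ℤ) : Set ℕ := {n : ℕ | ∃ m ∈ A, (n : ℤ) = (m : ℤ) + i}

/-- A shift-invariant family. -/
def ShiftInvariant (F : Set (Set ℕ)) : Prop := ∀ A ∈ F, ∀ i : ℤ, shiftSet A i ∈ F

/-- A shift₊-invariant family: `A + i ∈ F` for `i : ℕ`. -/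
def ShiftPlusInvariant (F : Set (Set ℕ)) : Prop :=
  ∀ A ∈ F, ∀ i : ℕ, (fun n => n + i) '' A ∈ F

/-- A thick family: `⋂_{i=0}^{k} ((A - i) ∩ ℕ) ∈ F` for all `A ∈ F`, `k ∈ ℕ`. -/
def ThickFamily (F : Set (Set ℕ)) : Prop :=
  ∀ A ∈ F, ∀ k : ℕ, {n : ℕ | ∀ i ≤ k, n + i ∈ A} ∈ F

/-- The dual family `F*`. -/
def dualFam (F : Set (Set ℕ)) : Set (Set ℕ) := {A | ∀ B ∈ F, (A ∩ B).Nonempty}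

/-- A full family. -/
def FullFamily (F : Set (Set ℕ)) : Prop :=
  ∀ A ∈ F, ∀ B ∈ dualFam F, (A ∩ B).Infinite

/-- `F̃`: the members `A` of `F` with `⋂_{i=-k}^{k} ((A + i) ∩ ℕ) ∈ F` for all `k ∈ ℕ`. -/
def tildeFam (F : Set (Set ℕ)) : Set (Set ℕ) :=
  {A ∈ F | ∀ k : ℕ, {n : ℕ | ∀ i : ℤ, |i| ≤ (k : ℤ) → n ∈ shiftSet A i} ∈ F}

/-- A thick subset of `ℕ`: contains arbitrarily long blocks of consecutive integers. -/
def IsThickSet (A : Set ℕ) : Prop := ∀ k : ℕ, ∃ n : ℕ, ∀ i ≤ k, n + i ∈ A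

/-- A syndetic subset of `ℕ` (bounded gaps). -/
def IsSyndetic (A : Set ℕ) : Prop := ∃ g : ℕ, ∀ n : ℕ, ∃ m ∈ A, n ≤ m ∧ m ≤ n + g

/-- A piecewise syndetic subset: intersection of a syndetic and a thick set. -/
def IsPiecewiseSyndetic (A : Set ℕ) : Prop :=
  ∃ S T : Set ℕ, IsSyndetic S ∧ IsThickSet T ∧ A = S ∩ T

/-- An IP-set. -/
def IsIPSet (A : Set ℕ) : Prop :=
  ∃ x : ℕ → ℕ, {n | x n ≠ 0}.Infinite ∧ ∀ s : Finset ℕ, s.Nonempty → (∑ i ∈ s, x i) ∈ A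

/-- `(A - A) ∩ ℕ` for `A ⊆ ℕ`: positive differences of distinct elements. -/
def diffSet (A : Set ℕ) : Set ℕ := {k | ∃ m ∈ A, ∃ n ∈ A, n < m ∧ k = m - n}

/-- The family `Δ*_ip`. -/
def deltaIPStar : Set (Set ℕ) :=
  {A | ∀ F : Set ℕ, IsIPSet F → (A ∩ diffSet F).Nonempty}

/- ### Operators on Fréchet spaces -/

/-- A (continuous linear) operator on an infinite-dimensional separable Fréchet space
(a complete metrizable locally convex topological vector space) over `ℝ` or `ℂ`
(an `RCLike` field). -/
structure FrechetOp where
  𝕜 : Type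
  [instField : RCLike 𝕜]
  X : Type
  [instAdd : AddCommGroup X]
  [instMod : Module 𝕜 X]
  [instUnif : UniformSpace X]
  [instUAG : IsUniformAddGroup X]
  [instSMul : ContinuousSMul 𝕜 X]
  [instComplete : CompleteSpace X]
  [instMetrizable : TopologicalSpace.MetrizableSpace X]
  [instSeparable : TopologicalSpace.SeparableSpace X]
  [instModR : Module ℝ X]
  [instTower : IsScalarTower ℝ 𝕜 X]
  [instLC : LocallyConvexSpace ℝ X]
  infDim : ¬ FiniteDimensional 𝕜 X
  T : X → X
  linear : IsLinearMap 𝕜 T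
  cont : Continuous T

attribute [instance] FrechetOp.instAdd FrechetOp.instMod
  FrechetOp.instUnif FrechetOp.instUAG FrechetOp.instSMul FrechetOp.instComplete
  FrechetOp.instMetrizable FrechetOp.instSeparable FrechetOp.instModR
  FrechetOp.instTower FrechetOp.instLC

/-- A bundled Fréchet-space operator is hypercyclic. -/
def FrechetOp.Hypercyclic (S : FrechetOp) : Prop := HypercyclicMap S.T

/-- A bundled Fréchet-space operator is invertible (a linear homeomorphism). -/
def FrechetOp.Invertible (S : FrechetOp) : Prop :=
  ∃ T' : S.X → S.X, Continuous T' ∧ (∀ x, T' (S.T x) = x) ∧ (∀ x, S.T (T' x) = x)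

/-- Mild mixing: weakly disjoint from every hypercyclic operator
(on every infinite-dimensional separable Fréchet space). -/
def MildlyMixing {X : Type*} [TopologicalSpace X] (T : X → X) : Prop :=
  ∀ S : FrechetOp, S.Hypercyclic → WeaklyDisjoint T S.T

/-- Topological ergodicity: all return time sets are syndetic. -/
def TopErgodic {X : Type*} [TopologicalSpace X] (T : X → X) : Prop :=
  ∀ U V : Set X, IsOpen U → IsOpen V → U.Nonempty → V.Nonempty → IsSyndetic (nset T U V)

/-- The `F`-Mixing Criterion for a map `T`. -/
def FMixCriterion {X : Type*} [TopologicalSpace X] [Zero X] (T : X → X)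
    (F : Set (Set ℕ)) : Prop :=
  ∃ X₀ Y₀ : Set X, Dense X₀ ∧ Dense Y₀ ∧ ∃ S : ℕ → X → X,
    ∀ x₀ ∈ X₀, ∀ y₀ ∈ Y₀, ∀ O ∈ nhds ((0, 0, y₀) : X × X × X),
      {n : ℕ | (T^[n] x₀, S n y₀, T^[n] (S n y₀)) ∈ O} ∈ F

/- ### Bilateral weighted backward shifts on `ℓᵖ(ℤ)` and `c₀(ℤ)` -/

/-- `B` is the bilateral weighted backward shift with (positive, bounded) weight `w` on
`ℓᵖ(ℤ)`; the condition that `1/w` is bounded makes it invertible. -/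
def IsInvertibleWBSlp (𝕜 : Type) [RCLike 𝕜] (p : ℝ≥0∞) [Fact (1 ≤ p)] (w : ℤ → ℝ)
    (B : lp (fun _ : ℤ => 𝕜) p →L[𝕜] lp (fun _ : ℤ => 𝕜) p) : Prop :=
  (∀ n, 0 < w n) ∧ (∃ C : ℝ, ∀ n, w n ≤ C) ∧ (∃ c : ℝ, 0 < c ∧ ∀ n, c ≤ w n) ∧
    ∀ (x : lp (fun _ : ℤ => 𝕜) p) (n : ℤ), B x n = w (n + 1) • x (n + 1)

/-- `B` is the bilateral weighted backward shift with (positive, bounded) weight `w` on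
`c₀(ℤ)`; the condition that `1/w` is bounded makes it invertible. -/
def IsInvertibleWBSc0 (𝕜 : Type) [RCLike 𝕜] (w : ℤ → ℝ)
    (B : ZeroAtInftyContinuousMap ℤ 𝕜 →L[𝕜] ZeroAtInftyContinuousMap ℤ 𝕜) : Prop :=
  (∀ n, 0 < w n) ∧ (∃ C : ℝ, ∀ n, w n ≤ C) ∧ (∃ c : ℝ, 0 < c ∧ ∀ n, c ≤ w n) ∧
    ∀ (x : ZeroAtInftyContinuousMap ℤ 𝕜) (n : ℤ), B x n = w (n + 1) • x (n + 1)
theorem prodMap_iter {X : Type*} (T : X → X) (n : ℕ) (p : X × X) :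
    (prodMap' T T)^[n] p = (T^[n] p.1, T^[n] p.2) := by
  induction n generalizing p with
  | zero => rfl
  | succ n ih => rw [iterate_succ_apply, ih]; rfl

theorem wmix_iff {X : Type*} [TopologicalSpace X] (T : X → X) :
    WMix T ↔ ∀ U₁ V₁ U₂ V₂ : Set X, IsOpen U₁ → IsOpen V₁ → IsOpen U₂ → IsOpen V₂ →
      U₁.Nonempty → V₁.Nonempty → U₂.Nonempty → V₂.Nonempty →
      (nset T U₁ V₁ ∩ nset T U₂ V₂).Nonempty := by
  constructor
  · intro h U₁ V₁ U₂ V₂ a b c d a' b' c' d'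
    obtain ⟨n, p, hp, hq⟩ := h (U₁ ×ˢ U₂) (V₁ ×ˢ V₂) (a.prod c) (b.prod d) (a'.prod c') (b'.prod d')
    rw [prodMap_iter] at hq
    exact ⟨n, ⟨p.1, hp.1, hq.1⟩, ⟨p.2, hp.2, hq.2⟩⟩
  · intro h U V hU hV ⟨u, hu⟩ ⟨v, hv⟩
    obtain ⟨U₁, U₂, a, c, a', c', hUs⟩ := isOpen_prod_iff.1 hU u.1 u.2 hu
    obtain ⟨V₁, V₂, b, d, b', d', hVs⟩ := isOpen_prod_iff.1 hV v.1 v.2 hv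
    obtain ⟨n, ⟨x, hx, hx'⟩, ⟨y, hy, hy'⟩⟩ :=
      h U₁ V₁ U₂ V₂ a b c d ⟨_, a'⟩ ⟨_, b'⟩ ⟨_, c'⟩ ⟨_, d'⟩
    refine ⟨n, (x, y), hUs ⟨hx, hy⟩, ?_⟩
    rw [prodMap_iter]
    exact hVs ⟨hx', hy'⟩

theorem wmix_trans {X : Type*} [TopologicalSpace X] {T : X → X} (h : WMix T) : TopTrans T := by
  intro U V a b a' b'
  obtain ⟨n, hn, -⟩ := (wmix_iff T).1 h U V U V a b a b a' b' a' b'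
  exact ⟨n, hn⟩

theorem wmix_filter {X : Type*} [TopologicalSpace X] {T : X → X} (hT : Continuous T)
    (h : WMix T) : ∅ ∉ NTfam T ∧ ∀ A ∈ NTfam T, ∀ B ∈ NTfam T, A ∩ B ∈ NTfam T := by
  refine ⟨?_, ?_⟩
  · rintro ⟨U, V, a, b, a', b', hs⟩
    obtain ⟨n, hn⟩ := wmix_trans h U V a b a' b'
    exact hs hn
  · rintro A ⟨U₁, V₁, a, b, a', b', hA⟩ B ⟨U₂, V₂, c, d, c', d', hB⟩
    obtain ⟨n, ⟨x, hx, hx'⟩, ⟨y, hy, hy'⟩⟩ :=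
      (wmix_iff T).1 h U₁ U₂ V₁ V₂ a c b d a' c' b' d'
    refine ⟨U₁ ∩ T^[n] ⁻¹' U₂, V₁ ∩ T^[n] ⁻¹' V₂, a.inter (c.preimage (hT.iterate n)),
      b.inter (d.preimage (hT.iterate n)), ⟨x, hx, hx'⟩, ⟨y, hy, hy'⟩, ?_⟩
    rintro m ⟨z, ⟨hz, hz'⟩, hw, hw'⟩
    refine ⟨hA ⟨z, hz, hw⟩, hB ⟨T^[n] z, hz', ?_⟩⟩
    have : T^[n] (T^[m] z) ∈ V₂ := hw'
    rwa [← iterate_add_apply, add_comm, iterate_add_apply] at this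

theorem filter_wmix {X : Type*} [TopologicalSpace X] {T : X → X}
    (h : ∅ ∉ NTfam T ∧ ∀ A ∈ NTfam T, ∀ B ∈ NTfam T, A ∩ B ∈ NTfam T) : WMix T := by
  rw [wmix_iff]
  intro U₁ V₁ U₂ V₂ a b c d a' b' c' d'
  rw [nonempty_iff_ne_empty]
  intro he
  apply h.1
  rw [← he]
  exact h.2 _ ⟨U₁, V₁, a, b, a', b', Subset.rfl⟩ _ ⟨U₂, V₂, c, d, c', d', Subset.rfl⟩

theorem trans_preimage {X : Type*} [TopologicalSpace X] [T2Space X] {T : X → X}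
    (h : TopTrans T) (V : Set X) (hV : IsOpen V) (hne : V.Nonempty) : (T ⁻¹' V).Nonempty := by
  obtain ⟨x, hx⟩ := hne
  by_cases hy : ∃ y, y ≠ x
  · obtain ⟨y, hy⟩ := hy
    obtain ⟨B, C, hB, hC, hyB, hxC, hd⟩ := t2_separation hy
    obtain ⟨n, z, hz, hz'⟩ := h B (V ∩ C) hB (hV.inter hC) ⟨y, hyB⟩ ⟨x, hx, hxC⟩
    cases n with
    | zero => exact (disjoint_left.1 hd hz hz'.2).elim
    | succ n =>
      rw [iterate_succ_apply'] at hz'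
      exact ⟨_, hz'.1⟩
  · push Not at hy
    refine ⟨x, ?_⟩
    rw [mem_preimage, hy (T x)]
    exact hx

theorem wmix_thick {X : Type*} [TopologicalSpace X] [T2Space X] {T : X → X} (hT : Continuous T)
    (h : WMix T) : FTrans T {A : Set ℕ | IsThickSet A} := by
  intro U V hU hV hU' hV' k
  obtain ⟨h0, hi⟩ := wmix_filter hT h
  have hpre : ∀ i : ℕ, (T^[i] ⁻¹' V).Nonempty := by
    intro i
    induction i with
    | zero => exact hV'
    | succ i ih =>
      rw [iterate_succ, preimage_comp]
      exact trans_preimage (wmix_trans h) _ (hV.preimage (hT.iterate i)) ih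
  have hm : ∀ i : ℕ, {n | n + i ∈ nset T U V} ∈ NTfam T := by
    intro i
    refine ⟨U, T^[i] ⁻¹' V, hU, hV.preimage (hT.iterate i), hU', hpre i, ?_⟩
    rintro n ⟨x, hx, hx'⟩
    refine ⟨x, hx, ?_⟩
    rw [add_comm, iterate_add_apply]
    exact hx'
  have key : ∀ k : ℕ, {n | ∀ i ≤ k, n + i ∈ nset T U V} ∈ NTfam T := by
    intro k
    induction k with
    | zero => simpa using hm 0
    | succ k ih =>
      have := hi _ ih _ (hm (k+1))
      convert this using 1
      ext n
      constructor
      · intro hn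
        exact ⟨fun i hik => hn i (by omega), hn _ le_rfl⟩
      · rintro ⟨h1, h2⟩ i hik
        rcases Nat.lt_or_ge k i with hlt | hge
        · obtain rfl : i = k + 1 := by omega
          exact h2
        · exact h1 i hge
  by_contra hcon
  apply h0
  have hk := key k
  rwa [show {n | ∀ i ≤ k, n + i ∈ nset T U V} = ∅ from
    eq_empty_iff_forall_notMem.2 fun n hn => hcon ⟨n, hn⟩] at hk

theorem thick_wmix {X : Type*} [TopologicalSpace X] {T : X → X} (hT : Continuous T)
    (h : FTrans T {A : Set ℕ | IsThickSet A}) : WMix T := by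
  have htr : TopTrans T := fun U V a b a' b' => by
    obtain ⟨n, hn⟩ := h U V a b a' b' 0
    exact ⟨_, hn 0 le_rfl⟩
  rw [wmix_iff]
  intro U₁ V₁ U₂ V₂ oa ob oc od na nb nc nd
  obtain ⟨a, x, hx⟩ := htr U₁ U₂ oa oc na nc
  obtain ⟨b, y, hy⟩ := htr V₁ V₂ ob od nb nd
  obtain ⟨n, hn⟩ := h (U₁ ∩ T^[a] ⁻¹' U₂) (V₁ ∩ T^[b] ⁻¹' V₂)
    (oa.inter (oc.preimage (hT.iterate a))) (ob.inter (od.preimage (hT.iterate b)))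
    ⟨x, hx⟩ ⟨y, hy⟩ (a + b)
  obtain ⟨z, hz, hz'⟩ := hn b (by omega)
  obtain ⟨w, hw, hw'⟩ := hn a (by omega)
  refine ⟨n + b, ⟨z, hz.1, hz'.1⟩, ⟨T^[a] w, hw.2, ?_⟩⟩
  have h2 : T^[b] (T^[n + a] w) ∈ V₂ := hw'.2
  rw [← iterate_add_apply] at h2 ⊢
  rwa [show n + b + a = b + (n + a) by omega]

/-- For a topological dynamical system `(X,T)` (a metric space with a
continuous self-map), the following are equivalent: (i) `T` is weakly mixing;
(ii) `T` is `F_t`-transitive (all return sets are thick); (iii) the family `N_T`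
generated by the return time sets is a filter (it does not contain `∅` and is closed
under finite intersections). -/
theorem weaklyMixing_iff_thickTransitive_iff_filter
    {X : Type*} [MetricSpace X] (T : X → X) (hT : Continuous T) :
    (WMix T ↔ FTrans T {A : Set ℕ | IsThickSet A}) ∧
    (WMix T ↔
      (∅ ∉ NTfam T ∧ ∀ A ∈ NTfam T, ∀ B ∈ NTfam T, A ∩ B ∈ NTfam T)) := by
  exact ⟨⟨wmix_thick hT, thick_wmix hT⟩, ⟨wmix_filter hT, filter_wmix⟩⟩
end

section
/- Let F be a shift₊-invariant Furstenberg family, i.e. F + i ∈ F for every F ∈ F and i ∈ ℕ. Let T : X → X and S : Y → Y be operators, and suppose S is hypercyclic. Then T ⊕ S is F-transitive if and only if for all nonempty open subsets U₁, U₂ of X and every nonempty open subset V of Y one has N_T(U₁,U₂) ∩ N_S(V,V) ∈ F. -/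
open Set Topology Function Filter
open scoped ENNReal

theorem nset_prodMap' {X Y : Type*} (T : X → X) (S : Y → Y) (n : ℕ) (p : X × Y) :
    (prodMap' T S)^[n] p = (T^[n] p.1, S^[n] p.2) := by
  induction n generalizing p with
  | zero => rfl
  | succ k ih => rw [iterate_succ_apply, ih]; rfl

theorem FrechetOp.neBot (S : FrechetOp) (x : S.X) : (𝓝[≠] x).NeBot := by
  letI := S.instField
  haveI : Nontrivial S.X := by
    by_contra h
    rw [not_nontrivial_iff_subsingleton] at h
    exact S.infDim inferInstance
  exact Module.punctured_nhds_neBot S.𝕜 S.X x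

theorem FrechetOp.topTrans (S : FrechetOp) (hS : S.Hypercyclic) : TopTrans S.T := by
  intro U V hU hV hUn hVn
  obtain ⟨x, hx⟩ := hS
  haveI := S.neBot
  obtain ⟨_, hmU, m, rfl⟩ := hx.inter_open_nonempty U hU hUn
  have hd := hx.diff_finite
    (((Set.finite_lt_nat m).image (fun n => S.T^[n] x)))
  obtain ⟨_, hkV, ⟨k, rfl⟩, hk⟩ := hd.inter_open_nonempty V hV hVn
  have hmk : m ≤ k := by
    by_contra h
    exact hk ⟨k, not_le.mp h, rfl⟩
  refine ⟨k - m, S.T^[m] x, hmU, ?_⟩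
  rw [← iterate_add_apply, Nat.sub_add_cancel hmk]
  exact hkV

theorem FrechetOp.preimage_nonempty (T : FrechetOp) (hT : TopTrans T.T)
    (n : ℕ) (U : Set T.X) (hU : IsOpen U) (hUn : U.Nonempty) :
    (T.T^[n] ⁻¹' U).Nonempty := by
  induction n generalizing U with
  | zero => exact hUn
  | succ k ih =>
    have key : (T.T ⁻¹' U).Nonempty := by
      obtain ⟨x, hx⟩ := hUn
      haveI := T.neBot x
      obtain ⟨y, hy⟩ := (inferInstance : (𝓝[≠] x).NeBot).nonempty_of_mem self_mem_nhdsWithin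
      obtain ⟨A, B, hA, hB, hxA, hyB, hAB⟩ := t2_separation (Ne.symm hy)
      obtain ⟨j, z, hzB, hz⟩ := hT B (A ∩ U) hB (hA.inter hU) ⟨y, hyB⟩ ⟨x, hxA, hx⟩
      cases j with
      | zero => exact absurd hzB (Set.disjoint_left.mp hAB hz.1)
      | succ j =>
        rw [iterate_succ_apply'] at hz
        exact ⟨_, hz.2⟩
    obtain ⟨z, hz⟩ := ih (T.T ⁻¹' U) (hU.preimage T.cont) key
    refine ⟨z, ?_⟩
    rw [mem_preimage, iterate_succ_apply']
    exact hz

/-- Let `F` be a shift₊-invariant Furstenberg family, and let `T`, `S`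
be operators with `S` hypercyclic. Then `T ⊕ S` is `F`-transitive iff
`N_T(U₁,U₂) ∩ N_S(V,V) ∈ F` for all nonempty open `U₁, U₂ ⊆ X` and nonempty open
`V ⊆ Y`. -/
theorem fTransitive_prod_iff_center
    (F : Set (Set ℕ)) (hF : IsFamily F) (hshift : ShiftPlusInvariant F)
    (T S : FrechetOp) (hS : S.Hypercyclic) :
    FTrans (prodMap' T.T S.T) F ↔
      ∀ (U₁ U₂ : Set T.X) (V : Set S.X), IsOpen U₁ → IsOpen U₂ → IsOpen V →
        U₁.Nonempty → U₂.Nonempty → V.Nonempty →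
        nset T.T U₁ U₂ ∩ nset S.T V V ∈ F := by
  constructor
  · intro h U₁ U₂ V hU₁ hU₂ hV n₁ n₂ nV
    refine hF.2.1 (h (U₁ ×ˢ V) (U₂ ×ˢ V) (hU₁.prod hV) (hU₂.prod hV) (n₁.prod nV) (n₂.prod nV)) ?_
    rintro n ⟨p, hp, hn⟩
    rw [nset_prodMap'] at hn
    exact ⟨⟨p.1, hp.1, hn.1⟩, ⟨p.2, hp.2, hn.2⟩⟩
  · intro h W₁ W₂ hW₁ hW₂ ⟨a, ha⟩ ⟨b, hb⟩
    have hT : TopTrans T.T := by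
      intro U V hU hV hUn hVn
      have h1 := h U V univ hU hV isOpen_univ hUn hVn ⟨a.2, trivial⟩
      by_contra h2
      rw [not_nonempty_iff_eq_empty] at h2
      rw [h2, empty_inter] at h1
      exact hF.2.2 h1
    obtain ⟨U₁, V₁, hU₁, hV₁, haU, haV, hs₁⟩ := isOpen_prod_iff.mp hW₁ a.1 a.2 ha
    obtain ⟨U₂, V₂, hU₂, hV₂, hbU, hbV, hs₂⟩ := isOpen_prod_iff.mp hW₂ b.1 b.2 hb
    obtain ⟨n, y, hy₁, hy₂⟩ := S.topTrans hS V₁ V₂ hV₁ hV₂ ⟨_, haV⟩ ⟨_, hbV⟩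
    have h1 := h U₁ (T.T^[n] ⁻¹' U₂) (V₁ ∩ S.T^[n] ⁻¹' V₂) hU₁
      (hU₂.preimage (T.cont.iterate n)) (hV₁.inter (hV₂.preimage (S.cont.iterate n)))
      ⟨_, haU⟩ (T.preimage_nonempty hT n U₂ hU₂ ⟨_, hbU⟩) ⟨y, hy₁, hy₂⟩
    refine hF.2.1 (hshift _ h1 n) ?_
    rintro _ ⟨m, ⟨⟨u, hu, hu'⟩, ⟨v, hv, hv'⟩⟩, rfl⟩
    refine ⟨(u, v), hs₁ ⟨hu, hv.1⟩, ?_⟩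
    rw [nset_prodMap']
    apply hs₂
    simp only [Nat.add_comm m n, iterate_add_apply]
    exact ⟨hu', hv'.2⟩
end

section
/- Let X = c₀(ℕ) or ℓ^p(ℕ) with 1 ≤ p < ∞. There exists a bounded sequence w = (w_n)_{n≥1} of positive real numbers such that the weighted backward shift B_w : X → X defined by (B_w x)_n = w_{n+1} x_{n+1} is a weakly mixing operator, while B_w ⊕ B_w² is not hypercyclic (no vector in X ⊕ X has dense orbit under B_w ⊕ B_w²). -/
open Set Topology Function Filter
open scoped ENNReal

namespace WShift

/-- Points far from all the powers `16 ^ k`. -/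
def Z : Set ℕ := {z | ∀ k : ℕ, (k : ℝ) ≤ |(z : ℝ) - 16 ^ k|}

/-- The products of the weights. -/
noncomputable def W (n : ℕ) : ℝ := 2 ^ (Metric.infDist n Z)

/-- The weights. -/
noncomputable def wt (n : ℕ) : ℝ := W n / W (n - 1)

lemma five_le (k : ℕ) : 5 * (k : ℝ) ≤ 16 ^ k := by
  induction k with
  | zero => simp
  | succ k ih =>
    rw [pow_succ]
    rcases Nat.eq_zero_or_pos k with rfl | hk
    · norm_num
    · have : (1 : ℝ) ≤ k := by exact_mod_cast hk
      push_cast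
      linarith

lemma zero_mem : (0 : ℕ) ∈ Z := by
  intro k
  have h := five_le k
  have : (0 : ℝ) ≤ k := by positivity
  rw [Nat.cast_zero, zero_sub, abs_neg, abs_of_nonneg (by positivity)]
  linarith

lemma W_pos (n : ℕ) : 0 < W n := by unfold W; positivity

lemma W_of_mem {n : ℕ} (h : n ∈ Z) : W n = 1 := by
  simp [W, Metric.infDist_zero_of_mem h]

lemma mem_or (n : ℕ) : n ∈ Z ∨ 2 * n ∈ Z := by
  by_contra! h
  obtain ⟨h1, h2⟩ := h
  simp only [Z, Set.mem_ofPred_eq, not_forall, not_le] at h1 h2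
  obtain ⟨k, hk⟩ := h1
  obtain ⟨j, hj⟩ := h2
  rw [abs_lt] at hk hj
  push_cast at hj
  have hk5 := five_le k
  have hj5 := five_le j
  have hk0 : (0 : ℝ) ≤ k := by positivity
  have hj0 : (0 : ℝ) ≤ j := by positivity
  rcases le_or_gt j k with hjk | hjk
  · have h3 : (16 : ℝ) ^ j ≤ 16 ^ k := pow_le_pow_right₀ (by norm_num) hjk
    have h4 : (j : ℝ) ≤ k := by exact_mod_cast hjk
    linarith [hk.1, hk.2, hj.1, hj.2]
  · have h3 : (16 : ℝ) ^ (k + 1) ≤ 16 ^ j := pow_le_pow_right₀ (by norm_num) hjk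
    rw [pow_succ] at h3
    have h4 : (k : ℝ) + 1 ≤ j := by exact_mod_cast hjk
    linarith [hk.1, hk.2, hj.1, hj.2]

lemma W_or (n : ℕ) : W n = 1 ∨ W (2 * n) = 1 :=
  (mem_or n).imp W_of_mem W_of_mem

lemma W_zero : W 0 = 1 := W_of_mem zero_mem

lemma W_big (i k : ℕ) : (2 : ℝ) ^ ((k : ℝ) - i) ≤ W (16 ^ k + i) := by
  unfold W
  apply Real.rpow_le_rpow_of_exponent_le (by norm_num)
  rw [Metric.le_infDist ⟨0, zero_mem⟩]
  intro y hy
  have h := hy k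
  rw [Nat.dist_eq]
  push_cast
  have h2 := abs_sub_le (y : ℝ) (16 ^ k + i) (16 ^ k)
  rw [abs_sub_comm]
  have h3 : |(16 : ℝ) ^ k + i - 16 ^ k| = i := by
    rw [add_sub_cancel_left, abs_of_nonneg (by positivity)]
  linarith

lemma wt_pos (n : ℕ) : 0 < wt n := div_pos (W_pos _) (W_pos _)

lemma wt_le (n : ℕ) : wt n ≤ 2 := by
  unfold wt
  rw [div_le_iff₀ (W_pos _)]
  unfold W
  nth_rewrite 2 [← Real.rpow_one 2]
  rw [← Real.rpow_add (by norm_num)]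
  apply Real.rpow_le_rpow_of_exponent_le (by norm_num)
  have h := Metric.infDist_le_infDist_add_dist (s := Z) (x := n) (y := n - 1)
  have h2 : dist n (n - 1) ≤ 1 := by
    rcases n with _ | n
    · simp
    · simp [Nat.dist_eq]
  linarith

lemma wt_mul (n : ℕ) : wt (n + 1) * W n = W (n + 1) := by
  unfold wt
  simp [(W_pos n).ne']

lemma tendsto_W (i : ℕ) : Tendsto (fun k : ℕ => W i / W (16 ^ k + i)) atTop (𝓝 0) := by
  have h1 : Tendsto (fun k : ℕ => W i * 2 ^ i * (1 / 2 : ℝ) ^ k) atTop (𝓝 0) := by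
    simpa using (tendsto_pow_atTop_nhds_zero_of_lt_one (r := (1 / 2 : ℝ)) (by norm_num)
      (by norm_num)).const_mul (W i * 2 ^ i)
  refine squeeze_zero (fun k => (div_pos (W_pos _) (W_pos _)).le) (fun k => ?_) h1
  rw [div_le_iff₀ (W_pos _)]
  have h := W_big i k
  rw [Real.rpow_sub (by norm_num), Real.rpow_natCast, Real.rpow_natCast] at h
  calc W i = W i * 2 ^ i * (1 / 2 : ℝ) ^ k * (2 ^ k / 2 ^ i) := by
        rw [one_div, inv_pow]; field_simp
    _ ≤ _ := by
        have := W_pos i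
        gcongr

section abstract_part

variable {𝕜 X : Type} [RCLike 𝕜] [NormedAddCommGroup X] [NormedSpace 𝕜 X]

lemma coord_iterate (c : ℕ → X →ₗ[𝕜] 𝕜) (B : X →L[𝕜] X)
    (hB : ∀ x n, c n (B x) = wt (n + 1) • c (n + 1) x) (n : ℕ) :
    ∀ (x : X) (m : ℕ), W m • c m (B^[n] x) = W (m + n) • c (m + n) x := by
  induction n with
  | zero => intro x m; simp
  | succ n ih =>
    intro x m
    rw [Function.iterate_succ_apply, ih (B x) m, hB, smul_smul, mul_comm, wt_mul]
    rfl

lemma not_hyper (c : ℕ → X →ₗ[𝕜] 𝕜) (hc : ∀ n x, ‖c n x‖ ≤ ‖x‖) (e : ℕ → X)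
    (he : ∀ n m, c m (e n) = if m = n then 1 else 0) (B : X →L[𝕜] X)
    (hB : ∀ x n, c n (B x) = wt (n + 1) • c (n + 1) x) :
    ¬ HypercyclicMap (prodMap' ⇑B ((⇑B)^[2])) := by
  rintro ⟨⟨x, y⟩, hxy⟩
  have hc0 : Continuous (c 0) :=
    AddMonoidHomClass.continuous_of_bound (c 0) 1 (fun x => by simpa using hc 0 x)
  set R := max ‖x‖ ‖y‖ with hR
  have hiter : ∀ n, (prodMap' ⇑B ((⇑B)^[2]))^[n] (x, y) = (B^[n] x, B^[2 * n] y) := by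
    intro n
    have : prodMap' ⇑B ((⇑B)^[2]) = Prod.map ⇑B ((⇑B)^[2]) := rfl
    rw [this, Prod.map_iterate, Function.iterate_mul]
    rfl
  let V : Set (X × X) := {q | R < ‖c 0 q.1‖ ∧ R < ‖c 0 q.2‖}
  have hV : IsOpen V :=
    (isOpen_lt continuous_const (hc0.comp continuous_fst).norm).inter
      (isOpen_lt continuous_const (hc0.comp continuous_snd).norm)
  have hR0 : 0 ≤ R := le_max_of_le_left (norm_nonneg x)
  have hn : R < ‖c 0 (((R + 1 : ℝ) : 𝕜) • e 0)‖ := by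
    rw [map_smul, he]
    simp only [if_true, smul_eq_mul, mul_one, RCLike.norm_ofReal]
    rw [abs_of_nonneg (by linarith)]
    linarith
  obtain ⟨q, hq, n, rfl⟩ := hxy.inter_open_nonempty V hV ⟨(_, _), hn, hn⟩
  simp only [hiter] at hq
  obtain ⟨h1, h2⟩ := hq
  have key : ∀ (z : X) (m : ℕ), W m = 1 → ‖c 0 (B^[m] z)‖ ≤ ‖z‖ := by
    intro z m hm
    have := coord_iterate c B hB m z 0
    rw [W_zero, zero_add, hm, one_smul, one_smul] at this
    rw [this]
    exact hc _ _
  rcases W_or n with h | h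
  · exact absurd (key x n h) (not_le.2 (lt_of_le_of_lt (le_max_left _ _) h1))
  · exact absurd (key y _ h) (not_le.2 (lt_of_le_of_lt (le_max_right _ _) h2))

lemma iterate_lin (B : X →L[𝕜] X) (n : ℕ) : (⇑B)^[n] = ⇑(B ^ n) := by
  ext x
  induction n generalizing x with
  | zero => simp
  | succ n ih => rw [Function.iterate_succ_apply, ih, pow_succ]; rfl

lemma wmix (c : ℕ → X →ₗ[𝕜] 𝕜) (hext : ∀ x y, (∀ n, c n x = c n y) → x = y) (e : ℕ → X)
    (he : ∀ n m, c m (e n) = if m = n then 1 else 0) (hen : ∀ n, ‖e n‖ ≤ 1)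
    (hd : Dense (Submodule.span 𝕜 (Set.range e) : Set X)) (B : X →L[𝕜] X)
    (hB : ∀ x n, c n (B x) = wt (n + 1) • c (n + 1) x) :
    WMix ⇑B := by
  have hshift : ∀ n i, (B ^ n) (e (n + i)) = ((W (n + i) / W i : ℝ) : 𝕜) • e i := by
    intro n i
    apply hext
    intro m
    have h := coord_iterate c B hB n (e (n + i)) m
    rw [iterate_lin] at h
    have h2 : c m ((B ^ n) (e (n + i))) = ((W (m + n) / W m : ℝ) : 𝕜) * c (m + n) (e (n + i)) := by
      have hW : ((W m : ℝ) : 𝕜) ≠ 0 := by exact_mod_cast (W_pos m).ne'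
      rw [RCLike.real_smul_eq_coe_mul, RCLike.real_smul_eq_coe_mul] at h
      rw [RCLike.ofReal_div, div_mul_eq_mul_div, eq_div_iff hW, mul_comm, h]
    rw [h2, map_smul, he, he, smul_eq_mul]
    by_cases hm : m = i
    · subst hm
      simp [add_comm]
    · rw [if_neg hm, if_neg (by omega)]; simp
  have hzero : ∀ n i, i < n → (B ^ n) (e i) = 0 := by
    intro n i hi
    apply hext
    intro m
    have h := coord_iterate c B hB n (e i) m
    rw [iterate_lin, he, if_neg (by omega), smul_zero] at h
    rw [map_zero]
    exact (smul_eq_zero.1 h).resolve_left (W_pos m).ne'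
  have hU : ∀ u ∈ Submodule.span 𝕜 (Set.range e), ∀ᶠ n in atTop, (B ^ n) u = 0 := by
    intro u hu
    induction hu using Submodule.span_induction with
    | mem x hx =>
      obtain ⟨i, rfl⟩ := hx
      filter_upwards [eventually_gt_atTop i] with n hn using hzero n i hn
    | zero => simp
    | add x y _ _ h1 h2 =>
      filter_upwards [h1, h2] with n h1 h2
      rw [map_add, h1, h2, add_zero]
    | smul a x _ h =>
      filter_upwards [h] with n h
      rw [map_smul, h, smul_zero]
  have hS : ∀ v ∈ Submodule.span 𝕜 (Set.range e), ∃ s : ℕ → X, (∀ n, (B ^ n) (s n) = v) ∧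
      Tendsto (fun k : ℕ => s (16 ^ k)) atTop (𝓝 0) := by
    intro v hv
    induction hv using Submodule.span_induction with
    | mem x hx =>
      obtain ⟨i, rfl⟩ := hx
      refine ⟨fun n => ((W i / W (n + i) : ℝ) : 𝕜) • e (n + i), fun n => ?_, ?_⟩
      · rw [map_smul, hshift, smul_smul, ← RCLike.ofReal_mul, div_mul_div_cancel₀ (W_pos _).ne',
          div_self (W_pos _).ne']
        simp
      · rw [tendsto_zero_iff_norm_tendsto_zero]
        refine squeeze_zero (fun _ => norm_nonneg _) (fun k => ?_) (tendsto_W i)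
        have h0 : 0 ≤ W i / W (16 ^ k + i) := (div_pos (W_pos _) (W_pos _)).le
        rw [norm_smul, RCLike.norm_ofReal, abs_of_nonneg h0]
        exact mul_le_of_le_one_right h0 (hen _)
    | zero => exact ⟨fun _ => 0, by simp, by simp⟩
    | add x y _ _ h1 h2 =>
      obtain ⟨s, hs, hs'⟩ := h1
      obtain ⟨t, ht, ht'⟩ := h2
      exact ⟨fun n => s n + t n, fun n => by rw [map_add, hs, ht], by simpa using hs'.add ht'⟩
    | smul a x _ h =>
      obtain ⟨s, hs, hs'⟩ := h
      exact ⟨fun n => a • s n, fun n => by rw [map_smul, hs], by simpa using hs'.const_smul a⟩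
  intro U V hUo hVo hUn hVn
  have hdd := hd.prod hd
  obtain ⟨⟨u1, u2⟩, hu, hu1, hu2⟩ := hdd.inter_open_nonempty U hUo hUn
  obtain ⟨⟨v1, v2⟩, hv, hv1, hv2⟩ := hdd.inter_open_nonempty V hVo hVn
  obtain ⟨s, hs, hs'⟩ := hS v1 hv1
  obtain ⟨t, ht, ht'⟩ := hS v2 hv2
  have hlim : Tendsto (fun k : ℕ => (u1 + s (16 ^ k), u2 + t (16 ^ k))) atTop (𝓝 (u1, u2)) := by
    apply Tendsto.prodMk_nhds
    · simpa using hs'.const_add u1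
    · simpa using ht'.const_add u2
  have hp : Tendsto (fun k : ℕ => 16 ^ k) atTop atTop :=
    tendsto_pow_atTop_atTop_of_one_lt (by norm_num)
  obtain ⟨k, h1, h2, h3⟩ := ((hlim.eventually (hUo.mem_nhds hu)).and
    ((hp.eventually (hU u1 hu1)).and (hp.eventually (hU u2 hu2)))).exists
  refine ⟨16 ^ k, _, h1, ?_⟩
  have : prodMap' ⇑B ⇑B = Prod.map ⇑B ⇑B := rfl
  rw [this, Prod.map_iterate, iterate_lin, Prod.map_apply, map_add, map_add, h2, h3, hs, ht,
    zero_add, zero_add]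
  exact hv

end abstract_part

section lp_part

variable {𝕜 : Type} [RCLike 𝕜] {p : ℝ≥0∞} [Fact (1 ≤ p)]

lemma p_pos : 0 < p := zero_lt_one.trans_le Fact.out

lemma sum_le (hp : p ≠ ∞) (x : lp (fun _ : ℕ => 𝕜) p) (s : Finset ℕ) :
    ∑ n ∈ s, ‖wt (n + 1) • x (n + 1)‖ ^ p.toReal ≤ (2 * ‖x‖) ^ p.toReal := by
  have hp' : 0 < p.toReal := ENNReal.toReal_pos p_pos.ne' hp
  rw [Real.mul_rpow (by norm_num) (norm_nonneg _)]
  calc ∑ n ∈ s, ‖wt (n + 1) • x (n + 1)‖ ^ p.toReal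
      ≤ ∑ n ∈ s, 2 ^ p.toReal * ‖x (n + 1)‖ ^ p.toReal := by
        apply Finset.sum_le_sum
        intro n _
        rw [← Real.mul_rpow (by norm_num) (norm_nonneg _), norm_smul, Real.norm_eq_abs,
          abs_of_pos (wt_pos _)]
        have := wt_le (n + 1)
        have := (wt_pos (n + 1)).le
        gcongr
    _ = 2 ^ p.toReal * ∑ n ∈ s.map (addRightEmbedding 1), ‖x n‖ ^ p.toReal := by
        rw [Finset.sum_map, Finset.mul_sum]; rfl
    _ ≤ _ := by
        gcongr
        exact lp.sum_rpow_le_norm_rpow hp' x _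

/-- The shift on `ℓᵖ`. -/
noncomputable def Blp (hp : p ≠ ∞) : lp (fun _ : ℕ => 𝕜) p →L[𝕜] lp (fun _ : ℕ => 𝕜) p :=
  LinearMap.mkContinuous
    { toFun := fun x => ⟨fun n => wt (n + 1) • x (n + 1), memℓp_gen' (sum_le hp x)⟩
      map_add' := fun x y => by
        ext n
        exact smul_add (wt (n + 1)) (x (n + 1)) (y (n + 1))
      map_smul' := fun a x => by
        ext n
        exact smul_comm (wt (n + 1)) a (x (n + 1)) }
    2 (fun x => lp.norm_le_of_forall_sum_le (ENNReal.toReal_pos p_pos.ne' hp) (by positivity)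
      (sum_le hp x))

lemma lp_main (hp : p ≠ ∞) : WMix ⇑(Blp (𝕜 := 𝕜) hp) ∧
    ¬ HypercyclicMap (prodMap' ⇑(Blp (𝕜 := 𝕜) hp) ((⇑(Blp (𝕜 := 𝕜) hp))^[2])) := by
  let c : ℕ → lp (fun _ : ℕ => 𝕜) p →ₗ[𝕜] 𝕜 := fun n =>
    { toFun := fun x => x n, map_add' := fun x y => rfl, map_smul' := fun a x => rfl }
  let e : ℕ → lp (fun _ : ℕ => 𝕜) p := fun n => lp.single p n 1
  have he : ∀ n m, c m (e n) = if m = n then 1 else 0 := by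
    intro n m
    change (lp.single p n (1 : 𝕜) : lp (fun _ : ℕ => 𝕜) p) m = _
    rw [lp.single_apply, Pi.single_apply]
  have hB : ∀ x n, c n (Blp hp x) = wt (n + 1) • c (n + 1) x := fun x n => rfl
  refine ⟨wmix c (fun x y h => by ext n; exact h n) e he (fun n => ?_) ?_ _ hB,
    not_hyper c (fun n x => lp.norm_apply_le_norm p_pos.ne' x n) e he _ hB⟩
  · exact ((lp.norm_single (E := fun _ : ℕ => 𝕜) p_pos n (1 : 𝕜)).trans norm_one).le
  · intro x
    refine mem_closure_of_tendsto (lp.hasSum_single hp x) (Eventually.of_forall fun s => ?_)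
    refine Submodule.sum_mem _ fun i _ => ?_
    have : lp.single p i (x i) = x i • e i := by
      have h := lp.single_smul (E := fun _ : ℕ => 𝕜) p i (x i) (1 : 𝕜)
      rw [smul_eq_mul, mul_one] at h
      exact h
    rw [this]
    exact Submodule.smul_mem _ _ (Submodule.subset_span ⟨i, rfl⟩)

end lp_part

section c0_part

variable {𝕜 : Type} [RCLike 𝕜]

lemma c0_norm_le {x : ZeroAtInftyContinuousMap ℕ 𝕜} {C : ℝ} (hC : 0 ≤ C)
    (h : ∀ n, ‖x n‖ ≤ C) : ‖x‖ ≤ C := by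
  rw [← ZeroAtInftyContinuousMap.norm_toBCF_eq_norm]
  exact (BoundedContinuousFunction.norm_le hC).2 h

lemma c0_le_norm (x : ZeroAtInftyContinuousMap ℕ 𝕜) (n : ℕ) : ‖x n‖ ≤ ‖x‖ := by
  rw [← ZeroAtInftyContinuousMap.norm_toBCF_eq_norm]
  exact x.toBCF.norm_coe_le_norm n

lemma c0_tendsto (x : ZeroAtInftyContinuousMap ℕ 𝕜) : Tendsto x atTop (𝓝 0) := by
  have := x.zero_at_infty'
  rw [cocompact_eq_cofinite, Nat.cofinite_eq_atTop] at this
  exact this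

/-- Build an element of `c₀`. -/
def mk0 (f : ℕ → 𝕜) (h : Tendsto f atTop (𝓝 0)) : ZeroAtInftyContinuousMap ℕ 𝕜 where
  toFun := f
  continuous_toFun := continuous_of_discreteTopology
  zero_at_infty' := by
    rw [cocompact_eq_cofinite, Nat.cofinite_eq_atTop]
    exact h

lemma c0_bound (x : ZeroAtInftyContinuousMap ℕ 𝕜) (n : ℕ) :
    ‖wt (n + 1) • x (n + 1)‖ ≤ 2 * ‖x (n + 1)‖ := by
  rw [norm_smul, Real.norm_eq_abs, abs_of_pos (wt_pos _)]
  have := wt_le (n + 1)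
  gcongr

lemma c0_shift (x : ZeroAtInftyContinuousMap ℕ 𝕜) :
    Tendsto (fun n => wt (n + 1) • x (n + 1)) atTop (𝓝 0) := by
  have h : Tendsto (fun n => 2 * ‖x (n + 1)‖) atTop (𝓝 0) := by
    simpa using (((tendsto_add_atTop_iff_nat 1).2 (c0_tendsto x)).norm).const_mul 2
  exact squeeze_zero_norm (c0_bound x) h

/-- The shift on `c₀`. -/
noncomputable def Bc0 :
    ZeroAtInftyContinuousMap ℕ 𝕜 →L[𝕜] ZeroAtInftyContinuousMap ℕ 𝕜 :=
  LinearMap.mkContinuous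
    { toFun := fun x => mk0 (fun n => wt (n + 1) • x (n + 1)) (c0_shift x)
      map_add' := fun x y => by
        ext n
        exact smul_add (wt (n + 1)) (x (n + 1)) (y (n + 1))
      map_smul' := fun a x => by
        ext n
        exact smul_comm (wt (n + 1)) a (x (n + 1)) }
    2 (fun x => c0_norm_le (by positivity) (fun n => (c0_bound x n).trans
      (mul_le_mul_of_nonneg_left (c0_le_norm x _) (by norm_num))))

lemma c0_main : WMix ⇑(Bc0 (𝕜 := 𝕜)) ∧
    ¬ HypercyclicMap (prodMap' ⇑(Bc0 (𝕜 := 𝕜)) ((⇑(Bc0 (𝕜 := 𝕜)))^[2])) := by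
  let c : ℕ → ZeroAtInftyContinuousMap ℕ 𝕜 →ₗ[𝕜] 𝕜 := fun n =>
    { toFun := fun x => x n, map_add' := fun x y => rfl, map_smul' := fun a x => rfl }
  let e : ℕ → ZeroAtInftyContinuousMap ℕ 𝕜 := fun n =>
    mk0 (fun m => if m = n then 1 else 0) (by
      refine tendsto_const_nhds.congr' ?_
      filter_upwards [eventually_gt_atTop n] with m hm
      rw [if_neg hm.ne'])
  have he : ∀ n m, c m (e n) = if m = n then 1 else 0 := fun n m => rfl
  have hB : ∀ x n, c n (Bc0 x) = wt (n + 1) • c (n + 1) x := fun x n => rfl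
  refine ⟨wmix c (fun x y h => by ext n; exact h n) e he (fun n => ?_) ?_ _ hB,
    not_hyper c (fun n x => c0_le_norm x n) e he _ hB⟩
  · refine c0_norm_le zero_le_one fun m => ?_
    change ‖(if m = n then 1 else 0 : 𝕜)‖ ≤ 1
    split_ifs <;> simp
  · intro x
    rw [Metric.mem_closure_iff]
    intro ε hε
    have h := (Metric.tendsto_atTop.1 (c0_tendsto x)) (ε / 2) (by positivity)
    obtain ⟨N, hN⟩ := h
    refine ⟨∑ i ∈ Finset.range N, x i • e i, Submodule.sum_mem _ fun i _ =>
      Submodule.smul_mem _ _ (Submodule.subset_span ⟨i, rfl⟩), ?_⟩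
    rw [dist_eq_norm]
    refine lt_of_le_of_lt (c0_norm_le (C := ε / 2) (by positivity) fun m => ?_) (by linarith)
    change ‖c m (x - ∑ i ∈ Finset.range N, x i • e i)‖ ≤ _
    rw [map_sub, map_sum]
    simp only [map_smul, he, smul_eq_mul, mul_ite, mul_one, mul_zero, Finset.sum_ite_eq,
      Finset.mem_range]
    change ‖x m - _‖ ≤ _
    split_ifs with hm
    · simp; positivity
    · have := hN m (not_lt.1 hm)
      rw [dist_zero_right] at this
      simpa using this.le

end c0_part

end WShift

/-- On `X = c₀(ℕ)` or `ℓᵖ(ℕ)`, `1 ≤ p < ∞`, there is a bounded positive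
weight sequence `w` such that the unilateral weighted backward shift `B_w` is weakly
mixing while `B_w ⊕ B_w²` is not hypercyclic. -/
theorem exists_weaklyMixing_shift_square_not_hypercyclic :
    (∀ (𝕜 : Type) [RCLike 𝕜] (p : ℝ≥0∞) [Fact (1 ≤ p)], p ≠ ∞ →
      ∃ w : ℕ → ℝ, (∀ n, 0 < w n) ∧ (∃ C : ℝ, ∀ n, w n ≤ C) ∧
        ∃ B : lp (fun _ : ℕ => 𝕜) p →L[𝕜] lp (fun _ : ℕ => 𝕜) p,
          (∀ (x : lp (fun _ : ℕ => 𝕜) p) (n : ℕ), B x n = w (n + 1) • x (n + 1)) ∧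
          WMix ⇑B ∧ ¬ HypercyclicMap (prodMap' ⇑B ((⇑B)^[2]))) ∧
    (∀ (𝕜 : Type) [RCLike 𝕜],
      ∃ w : ℕ → ℝ, (∀ n, 0 < w n) ∧ (∃ C : ℝ, ∀ n, w n ≤ C) ∧
        ∃ B : ZeroAtInftyContinuousMap ℕ 𝕜 →L[𝕜] ZeroAtInftyContinuousMap ℕ 𝕜,
          (∀ (x : ZeroAtInftyContinuousMap ℕ 𝕜) (n : ℕ), B x n = w (n + 1) • x (n + 1)) ∧
          WMix ⇑B ∧ ¬ HypercyclicMap (prodMap' ⇑B ((⇑B)^[2]))) := by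
  refine ⟨fun 𝕜 _ p _ hp => ⟨WShift.wt, WShift.wt_pos, ⟨2, WShift.wt_le⟩, WShift.Blp hp,
    fun x n => rfl, WShift.lp_main hp⟩, fun 𝕜 _ => ⟨WShift.wt, WShift.wt_pos, ⟨2, WShift.wt_le⟩,
    WShift.Bc0, fun x n => rfl, WShift.c0_main⟩⟩
end

section
/- Let F be a Furstenberg family and let T : X → X be an operator. Then T is F-mixing if and only if for all nonempty open subsets U, V of X and every neighborhood W of 0 in X one has N(U,W) ∩ N(W,V) ∈ F. -/
open Set Topology Function Filter
open scoped ENNReal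

theorem bc_add {X : Type*} [AddCommGroup X] {f : X → X} (hf : ∀ x y, f (x + y) = f x + f y)
    (n : ℕ) (x y : X) : f^[n] (x + y) = f^[n] x + f^[n] y := by
  induction n generalizing x y with
  | zero => rfl
  | succ n ih => simp only [Function.iterate_succ, Function.comp_apply, hf, ih]

theorem bc_split {X : Type*} [AddCommGroup X] [TopologicalSpace X] [ContinuousAdd X]
    {U : Set X} (hU : IsOpen U) (hne : U.Nonempty) :
    ∃ A : Set X, IsOpen A ∧ A.Nonempty ∧ ∃ B ∈ nhds (0 : X), ∀ a ∈ A, ∀ b ∈ B, a + b ∈ U := by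
  obtain ⟨u, hu⟩ := hne
  have h : Tendsto (fun p : X × X => p.1 + p.2) (nhds (u, 0)) (nhds (u + 0)) :=
    continuous_add.tendsto (u, 0)
  rw [add_zero] at h
  have h2 := h (hU.mem_nhds hu)
  rw [Filter.mem_map, nhds_prod_eq, Filter.mem_prod_iff] at h2
  obtain ⟨A, hA, B, hB, hAB⟩ := h2
  obtain ⟨A', hA', hoA, huA⟩ := mem_nhds_iff.1 hA
  exact ⟨A', hoA, ⟨u, huA⟩, B, hB, fun a ha b hb => hAB (Set.mk_mem_prod (hA' ha) hb)⟩

theorem bc_prod_iter {X : Type*} (f : X → X) (n : ℕ) (p : X × X) :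
    (prodMap' f f)^[n] p = (f^[n] p.1, f^[n] p.2) := by
  induction n generalizing p with
  | zero => rfl
  | succ n ih => simp only [Function.iterate_succ, Function.comp_apply, ih, prodMap']

theorem bc_main {X : Type*} [AddCommGroup X] [TopologicalSpace X] [ContinuousAdd X]
    (F : Set (Set ℕ)) (hF : IsFamily F) (f : X → X) (hf : ∀ x y, f (x + y) = f x + f y)
    (hc : Continuous f) :
    FMix f F ↔
      ∀ U V : Set X, IsOpen U → IsOpen V → U.Nonempty → V.Nonempty →
        ∀ W ∈ nhds (0 : X), nset f U W ∩ nset f W V ∈ F := by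
  obtain ⟨-, hup, hemp⟩ := hF
  have h0 : ∀ n, f^[n] 0 = 0 := by
    intro n
    have := bc_add hf n 0 0
    simpa using this
  have hpre : ∀ n, ∀ B ∈ nhds (0 : X), f^[n] ⁻¹' B ∈ nhds (0 : X) := by
    intro n B hB
    apply (hc.iterate n).continuousAt.preimage_mem_nhds
    rwa [h0]
  constructor
  · intro h U V hU hV hUn hVn W hW
    obtain ⟨W', hW', hoW, h0W⟩ := mem_nhds_iff.1 hW
    refine hup (h (U ×ˢ W') (W' ×ˢ V) (hU.prod hoW) (hoW.prod hV) (hUn.prod ⟨0, h0W⟩)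
      (Set.Nonempty.prod ⟨0, h0W⟩ hVn)) ?_
    rintro n ⟨p, hp, hp2⟩
    rw [bc_prod_iter] at hp2
    exact ⟨⟨p.1, hp.1, hW' hp2.1⟩, ⟨p.2, hW' hp.2, hp2.2⟩⟩
  · intro h
    have htr : ∀ U V : Set X, IsOpen U → IsOpen V → U.Nonempty → V.Nonempty →
        ∃ n, (U ∩ f^[n] ⁻¹' V).Nonempty := by
      intro U V hU hV hUn hVn
      obtain ⟨A, hA, hAn, B, hB, hAB⟩ := bc_split hU hUn
      obtain ⟨C, hC, hCn, D, hD, hCD⟩ := bc_split hV hVn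
      have h1 := h A C hA hC hAn hCn (B ∩ D) (Filter.inter_mem hB hD)
      have h2 : (nset f A (B ∩ D) ∩ nset f (B ∩ D) C).Nonempty := by
        rw [Set.nonempty_iff_ne_empty]
        intro he
        exact hemp (he ▸ h1)
      obtain ⟨n, ⟨x, hx, hx2⟩, ⟨y, hy, hy2⟩⟩ := h2
      refine ⟨n, x + y, hAB x hx y hy.1, ?_⟩
      rw [Set.mem_preimage, bc_add hf, add_comm]
      exact hCD _ hy2 _ hx2.2
    intro U V hU hV hUn hVn
    obtain ⟨⟨u1, u2⟩, hu⟩ := hUn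
    obtain ⟨⟨v1, v2⟩, hv⟩ := hVn
    obtain ⟨U1, U2, hU1, hU2, hu1, hu2, hUU⟩ := isOpen_prod_iff.1 hU u1 u2 hu
    obtain ⟨V1, V2, hV1, hV2, hv1, hv2, hVV⟩ := isOpen_prod_iff.1 hV v1 v2 hv
    obtain ⟨A1, hA1, hA1n, B1, hB1, hAB1⟩ := bc_split hU1 ⟨u1, hu1⟩
    obtain ⟨A2, hA2, hA2n, B2, hB2, hAB2⟩ := bc_split hU2 ⟨u2, hu2⟩
    obtain ⟨C1, hC1, hC1n, D1, hD1, hCD1⟩ := bc_split hV1 ⟨v1, hv1⟩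
    obtain ⟨C2, hC2, hC2n, D2, hD2, hCD2⟩ := bc_split hV2 ⟨v2, hv2⟩
    obtain ⟨k, hk⟩ := htr A1 A2 hA1 hA2 hA1n hA2n
    obtain ⟨m, hm⟩ := htr C1 C2 hC1 hC2 hC1n hC2n
    refine hup (h (A1 ∩ f^[k] ⁻¹' A2) (C1 ∩ f^[m] ⁻¹' C2)
      (hA1.inter (hA2.preimage (hc.iterate k))) (hC1.inter (hC2.preimage (hc.iterate m))) hk hm
      ((B1 ∩ f^[m] ⁻¹' B2) ∩ (D1 ∩ f^[k] ⁻¹' D2))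
      (Filter.inter_mem (Filter.inter_mem hB1 (hpre m _ hB2))
        (Filter.inter_mem hD1 (hpre k _ hD2)))) ?_
    rintro n ⟨⟨x, hx, hx2⟩, ⟨y, hy, hy2⟩⟩
    refine ⟨(x + y, f^[k] x + f^[m] y),
      hUU ⟨hAB1 x hx.1 y hy.1.1, hAB2 _ hx.2 _ hy.1.2⟩, ?_⟩
    rw [bc_prod_iter]
    refine hVV ⟨?_, ?_⟩
    · change f^[n] (x + y) ∈ V1
      rw [bc_add hf, add_comm]
      exact hCD1 _ hy2.1 _ hx2.2.1
    · change f^[n] (f^[k] x + f^[m] y) ∈ V2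
      rw [bc_add hf, add_comm, ← Function.iterate_add_apply, ← Function.iterate_add_apply,
        Nat.add_comm n m, Nat.add_comm n k, Function.iterate_add_apply,
        Function.iterate_add_apply]
      exact hCD2 _ hy2.2 _ hx2.2.2


/-- (Blow up/Collapse for `F`-mixing.) An operator `T` is `F`-mixing iff
for all nonempty open `U, V ⊆ X` and every neighborhood `W` of `0`,
`N(U,W) ∩ N(W,V) ∈ F`. -/
theorem fMixing_iff_blowupCollapse
    (F : Set (Set ℕ)) (hF : IsFamily F) (T : FrechetOp) :
    FMix T.T F ↔
      ∀ U V : Set T.X, IsOpen U → IsOpen V → U.Nonempty → V.Nonempty →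
        ∀ W ∈ nhds (0 : T.X), nset T.T U W ∩ nset T.T W V ∈ F := by
  let _ := T.instField
  exact bc_main F hF T.T T.linear.map_add T.cont
end

section
/- Let T : X → X and S : Y → Y be operators. Then the direct sum T ⊕ S is mildly mixing if and only if both T and S are mildly mixing. -/
open Set Topology Function Filter
open scoped ENNReal

theorem hypercyclic_of_factor {X Y : Type*} [TopologicalSpace X] [TopologicalSpace Y]
    {T : X → X} {S : Y → Y} (h : HypercyclicMap T) (p : X → Y) (hp : Continuous p)
    (hs : Function.Surjective p) (hc : Function.Semiconj p T S) : HypercyclicMap S := by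
  obtain ⟨x, hx⟩ := h
  refine ⟨p x, ?_⟩
  have h2 := hs.denseRange.dense_image hp hx
  rw [← Set.range_comp] at h2
  convert h2 using 2
  funext n
  exact ((hc.iterate_right n) x).symm

theorem FrechetOp.continuousSMul_real (S : FrechetOp) : ContinuousSMul ℝ S.X := by
  letI := S.instField
  refine ⟨?_⟩
  have h : (fun p : ℝ × S.X => p.1 • p.2) = fun p => (algebraMap ℝ S.𝕜 p.1) • p.2 := by
    funext p
    rw [algebraMap_smul]
  rw [h]
  exact ((RCLike.continuous_ofReal (K := S.𝕜)).comp continuous_fst).smul continuous_snd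

theorem FrechetOp.linear_real (S : FrechetOp) : IsLinearMap ℝ S.T := by
  letI := S.instField
  refine ⟨S.linear.map_add, fun c x => ?_⟩
  rw [← algebraMap_smul S.𝕜 c x, S.linear.map_smul, algebraMap_smul]

theorem FrechetOp.infDim_real (S : FrechetOp) : ¬ FiniteDimensional ℝ S.X := by
  letI := S.instField
  intro h
  exact S.infDim (Module.Finite.of_restrictScalars_finite ℝ S.𝕜 S.X)

/-- The direct sum of two operators, as a real operator. -/
noncomputable def FrechetOp.sum (S R : FrechetOp) : FrechetOp :=
  haveI := S.continuousSMul_real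
  haveI := R.continuousSMul_real
  { 𝕜 := ℝ
    X := S.X × R.X
    infDim := fun h => S.infDim_real
      (Module.Finite.of_surjective (LinearMap.fst ℝ S.X R.X) LinearMap.fst_surjective)
    T := prodMap' S.T R.T
    linear := ⟨fun x y => Prod.ext (S.linear_real.map_add _ _) (R.linear_real.map_add _ _),
      fun c x => Prod.ext (S.linear_real.map_smul _ _) (R.linear_real.map_smul _ _)⟩
    cont := (S.cont.comp continuous_fst).prodMk (R.cont.comp continuous_snd) }

/-- The direct sum `T ⊕ S` of two operators is mildly mixing iff both
`T` and `S` are mildly mixing. -/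
theorem mildlyMixing_prod_iff (T S : FrechetOp) :
    MildlyMixing (prodMap' T.T S.T) ↔ MildlyMixing T.T ∧ MildlyMixing S.T := by
  constructor
  · intro h
    refine ⟨fun R hR => ?_, fun R hR => ?_⟩
    · exact hypercyclic_of_factor (h R hR) (fun q => (q.1.1, q.2)) (by fun_prop)
        (fun q => ⟨((q.1, 0), q.2), rfl⟩) (fun q => rfl)
    · exact hypercyclic_of_factor (h R hR) (fun q => (q.1.2, q.2)) (by fun_prop)
        (fun q => ⟨((0, q.1), q.2), rfl⟩) (fun q => rfl)
  · rintro ⟨hT, hS⟩ R hR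
    have h1 : WeaklyDisjoint T.T (prodMap' S.T R.T) := hT (S.sum R) (hS R hR)
    exact hypercyclic_of_factor h1 (fun q => ((q.1, q.2.1), q.2.2)) (by fun_prop)
      (fun q => ⟨(q.1.1, (q.1.2, q.2)), rfl⟩) (fun q => rfl)
end

section
/- Every Δ*_ip-transitive operator is mildly mixing; that is, if T : X → X is an operator such that N(U,V) ∈ Δ*_ip for all nonempty open subsets U, V of X, then T is weakly disjoint from every hypercyclic operator. -/
open Set Topology Function Filter
open scoped ENNReal

/-- Birkhoff: transitivity implies hypercyclicity. -/
theorem hypercyclic_of_topTrans {X : Type*} [TopologicalSpace X] [BaireSpace X]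
    [SecondCountableTopology X] [Nonempty X] (T : X → X) (hT : Continuous T)
    (h : TopTrans T) : HypercyclicMap T := by
  have hd : Dense (⋂ B ∈ TopologicalSpace.countableBasis X, ⋃ n : ℕ, (T^[n]) ⁻¹' B) := by
    apply dense_biInter_of_isOpen
    · intro B hB
      exact isOpen_iUnion fun n =>
        (TopologicalSpace.isOpen_of_mem_countableBasis hB).preimage (hT.iterate n)
    · exact TopologicalSpace.countable_countableBasis X
    · intro B hB
      rw [dense_iff_inter_open]
      intro U hU hUne
      obtain ⟨n, x, hx, hx'⟩ := h U B hU (TopologicalSpace.isOpen_of_mem_countableBasis hB) hUne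
        (TopologicalSpace.nonempty_of_mem_countableBasis hB)
      exact ⟨x, hx, Set.mem_iUnion.2 ⟨n, hx'⟩⟩
  obtain ⟨x, hx⟩ := hd.nonempty
  refine ⟨x, ?_⟩
  rw [(TopologicalSpace.isBasis_countableBasis X).dense_iff]
  intro B hB _
  obtain ⟨n, hn⟩ := Set.mem_iUnion.1 (Set.mem_iInter₂.1 hx B hB)
  exact ⟨_, hn, n, rfl⟩

/-- Return times of a recurrent point form an IP-set. -/
theorem isIPSet_of_recurrent {Y : Type*} [TopologicalSpace Y] (S : Y → Y) (hS : Continuous S)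
    (y : Y) (hrec : ∀ O : Set Y, IsOpen O → y ∈ O → ∃ n, 0 < n ∧ S^[n] y ∈ O)
    (W : Set Y) (hW : IsOpen W) (hy : y ∈ W) : IsIPSet {n | S^[n] y ∈ W} := by
  choose! r hr0 hr using hrec
  let next : Set Y → Set Y := fun O => O ∩ (S^[r O]) ⁻¹' O
  let O : ℕ → Set Y := fun k => next^[k] W
  have hs : ∀ k, O (k + 1) = O k ∩ (S^[r (O k)]) ⁻¹' (O k) := fun k =>
    Function.iterate_succ_apply' next k W
  have hO : ∀ k, IsOpen (O k) ∧ y ∈ O k := by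
    intro k
    induction k with
    | zero => exact ⟨hW, hy⟩
    | succ k ih =>
      rw [hs]
      exact ⟨ih.1.inter (ih.1.preimage (hS.iterate _)), ih.2, hr _ ih.1 ih.2⟩
  have hanti : Antitone O := antitone_nat_of_succ_le fun k => by
    rw [hs]; exact Set.inter_subset_left
  have key : ∀ s : Finset ℕ, s.Nonempty → ∀ k, (∀ i ∈ s, k ≤ i) →
      S^[∑ i ∈ s, r (O i)] y ∈ O k := by
    intro s
    induction s using Finset.induction_on_min with
    | empty => intro h; exact absurd h (by simp)
    | insert a s ha ih =>
      intro _ k hk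
      have hka : k ≤ a := hk a (by simp)
      apply hanti hka
      rw [Finset.sum_insert (fun h => lt_irrefl _ (ha a h))]
      rcases s.eq_empty_or_nonempty with rfl | hne
      · simpa using hr _ (hO a).1 (hO a).2
      · have h1 := ih hne (a + 1) (fun i hi => ha i hi)
        rw [hs] at h1
        rw [Function.iterate_add_apply]
        exact h1.2
  refine ⟨fun i => r (O i), ?_, fun s hs => key s hs 0 (by simp)⟩
  have : {n | r (O n) ≠ 0} = Set.univ :=
    Set.eq_univ_of_forall fun n => (hr0 _ (hO n).1 (hO n).2).ne'
  rw [this]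
  exact Set.infinite_univ

theorem preimage_nonempty_of_deltaIPStar {X : Type*} [TopologicalSpace X] [Nonempty X]
    (T : X → X) (h : FTrans T deltaIPStar) (V : Set X) (hV : IsOpen V) (hne : V.Nonempty) (m : ℕ) :
    ((T^[m]) ⁻¹' V).Nonempty := by
  have hF : IsIPSet {n | (m + 1) ∣ n} := by
    refine ⟨fun _ => m + 1, ?_, fun s _ => Finset.dvd_sum fun _ _ => dvd_rfl⟩
    simpa using Set.infinite_univ
  obtain ⟨k, ⟨x, _, hx⟩, a, ha, b, hb, hlt, hk⟩ :=
    h Set.univ V isOpen_univ hV Set.univ_nonempty hne _ hF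
  have hd : (m + 1) ∣ k := hk ▸ Nat.dvd_sub ha hb
  have hle : m + 1 ≤ k := Nat.le_of_dvd (by omega) hd
  refine ⟨T^[k - m] x, ?_⟩
  rw [Set.mem_preimage, ← Function.iterate_add_apply, show m + (k - m) = k by omega]
  exact hx

theorem topTrans_prod {X Y : Type*} [TopologicalSpace X] [Nonempty X] [TopologicalSpace Y]
    [T1Space Y] [∀ y : Y, (nhdsWithin y {y}ᶜ).NeBot] (T : X → X) (hT : Continuous T)
    (S : Y → Y) (hS : Continuous S)
    (h : FTrans T deltaIPStar) (hh : HypercyclicMap S) : TopTrans (prodMap' T S) := by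
  obtain ⟨y₀, hy₀⟩ := hh
  have hit : ∀ (a : ℕ) (O : Set Y), IsOpen O → O.Nonempty → ∃ b, a < b ∧ S^[b] y₀ ∈ O := by
    classical
    intro a O hO hne
    obtain ⟨_, hz, ⟨b, rfl⟩, hb⟩ :=
      (hy₀.diff_finset ((Finset.range (a + 1)).image fun n => S^[n] y₀)).inter_open_nonempty O hO hne
    refine ⟨b, ?_, hz⟩
    by_contra hab
    exact hb (by
      rw [Finset.mem_coe]
      exact Finset.mem_image_of_mem _ (Finset.mem_range.2 (by omega)))
  have hiter : ∀ n p, (prodMap' T S)^[n] p = (T^[n] p.1, S^[n] p.2) := by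
    intro n
    induction n with
    | zero => intro p; rfl
    | succ n ih => intro p; rw [Function.iterate_succ_apply, ih]; rfl
  intro A B hA hB ⟨⟨u, w⟩, hA'⟩ ⟨⟨v, z⟩, hB'⟩
  obtain ⟨U, W, hU, hW, hu, hw, hUW⟩ := isOpen_prod_iff.1 hA u w hA'
  obtain ⟨V, Z, hV, hZ, hv, hz, hVZ⟩ := isOpen_prod_iff.1 hB v z hB'
  obtain ⟨a, -, ha⟩ := hit 0 W hW ⟨w, hw⟩
  obtain ⟨b, hab, hb⟩ := hit a Z hZ ⟨z, hz⟩
  have hadd : ∀ c, a < c → S^[c - a] (S^[a] y₀) = S^[c] y₀ := by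
    intro c hc
    rw [← Function.iterate_add_apply, Nat.sub_add_cancel hc.le]
  have hIP := isIPSet_of_recurrent S hS (S^[a] y₀) (by
      intro O hO hmem
      obtain ⟨c, hc, hc'⟩ := hit a O hO ⟨_, hmem⟩
      exact ⟨c - a, by omega, by rw [hadd c hc]; exact hc'⟩)
    (W ∩ (S^[b - a]) ⁻¹' Z) (hW.inter (hZ.preimage (hS.iterate _)))
    ⟨ha, by rw [Set.mem_preimage, hadd b hab]; exact hb⟩
  obtain ⟨k, ⟨x, hxU, hxV⟩, p, hp, q, hq, hlt, hk⟩ :=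
    h U ((T^[b - a]) ⁻¹' V) hU (hV.preimage (hT.iterate _)) ⟨u, hu⟩
      (preimage_nonempty_of_deltaIPStar T h V hV ⟨v, hv⟩ _) _ hIP
  refine ⟨(b - a) + k, (x, S^[q] (S^[a] y₀)), hUW ⟨hxU, hq.1⟩, ?_⟩
  rw [hiter]
  apply hVZ
  refine ⟨?_, ?_⟩
  · show T^[b - a + k] x ∈ V
    rw [Function.iterate_add_apply]; exact hxV
  · show S^[b - a + k] (S^[q] (S^[a] y₀)) ∈ Z
    rw [Function.iterate_add_apply, ← Function.iterate_add_apply S k q,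
      show k + q = p by omega]
    exact hp.2

/-- Every `Δ*_ip`-transitive operator is mildly mixing, i.e. weakly
disjoint from every hypercyclic operator. -/
theorem mildlyMixing_of_deltaIPStar_transitive (T : FrechetOp)
    (h : FTrans T.T deltaIPStar) : MildlyMixing T.T := by
  intro S hS
  letI := S.instField
  haveI : Nontrivial S.X := by
    by_contra hn
    rw [not_nontrivial_iff_subsingleton] at hn
    exact S.infDim inferInstance
  haveI : ∀ y : S.X, (nhdsWithin y {y}ᶜ).NeBot := Module.punctured_nhds_neBot S.𝕜 S.X
  haveI : (uniformity T.X).IsCountablyGenerated := IsUniformAddGroup.uniformity_countably_generated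
  haveI : (uniformity S.X).IsCountablyGenerated := IsUniformAddGroup.uniformity_countably_generated
  haveI : SecondCountableTopology T.X := UniformSpace.secondCountable_of_separable T.X
  haveI : SecondCountableTopology S.X := UniformSpace.secondCountable_of_separable S.X
  have hc : Continuous (prodMap' T.T S.T) :=
    (T.cont.comp continuous_fst).prodMk (S.cont.comp continuous_snd)
  exact hypercyclic_of_topTrans _ hc (topTrans_prod T.T T.cont S.T S.cont h hS)
end
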